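/- Let M be an inverse monoid acting on a set Q by injective partial functions via act : M → Q → Option Q, and suppose act m q₁ = some q₂ for some m ∈ M and q₁, q₂ ∈ Q. Then m⁻¹ * h * m ∈ Stab(q₂) for every h ∈ Stab(q₁), and m * k * m⁻¹ ∈ Stab(q₁) for every k ∈ Stab(q₂); in particular, Stab(q₁) and Stab(q₂) are conjugate closed inverse submonoids of M. -/

import Mathlib

/-- `i` is the inverse operation of an inverse monoid structure on `M`. -/
def IsInverseMonoidInv (M : Type*) [Monoid M] (i : M → M) : Prop :=
  (∀ a : M, a * i a * a = a) ∧ (∀ a : M, i a * a * i a = i a) ∧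
    ∀ a b : M, a * b * a = a → b * a * b = b → b = i a

/-- `act` is an action of the monoid `M` on the set `Q` by injective partial
functions. -/
def IsPartialAction {M Q : Type*} [Monoid M] (act : M → Q → Option Q) : Prop :=
  (∀ q : Q, act 1 q = some q) ∧
  (∀ (m n : M) (q : Q), act (m * n) q = (act m q).bind (act n)) ∧
  (∀ (m : M) (q₁ q₂ r : Q), act m q₁ = some r → act m q₂ = some r → q₁ = q₂)

/-- If `act m q₁ = some q₂` then the inverse of `m` sends `q₂` back to `q₁`. -/
theorem act_inv_of_act {M Q : Type*} [Monoid M] (i : M → M)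
    (hi : IsInverseMonoidInv M i) (act : M → Q → Option Q)
    (hact : IsPartialAction act) (m : M) (q₁ q₂ : Q)
    (hm : act m q₁ = some q₂) : act (i m) q₂ = some q₁ := by
  obtain ⟨_, hmul, hinj⟩ := hact
  have h := hmul (m * i m) m q₁
  rw [hi.1 m, hm, hmul, hm, Option.bind_some] at h
  cases hr : act (i m) q₂ with
  | none => simp [hr] at h
  | some r =>
    rw [hr, Option.bind_some] at h
    rw [hinj m q₁ r q₂ hm h.symm]

/-- Stabilizers are closed inverse submonoids (the part of the informal statement
not spelled out in `stab_conjugate`). -/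
theorem stab_closed_inverse_submonoid {M Q : Type*} [Monoid M] (i : M → M)
    (hi : IsInverseMonoidInv M i) (act : M → Q → Option Q)
    (hact : IsPartialAction act) (q : Q) :
    act 1 q = some q ∧
    (∀ a b : M, act a q = some q → act b q = some q → act (a * b) q = some q) ∧
    (∀ a : M, act a q = some q → act (i a) q = some q) ∧
    {b : M | ∃ h : M, act h q = some q ∧ ∃ e : M, e * e = e ∧ h = e * b} =
      {b : M | act b q = some q} := by
  refine ⟨hact.1 q, fun a b ha hb => by rw [hact.2.1, ha, Option.bind_some, hb],
    fun a ha => act_inv_of_act i hi act hact a q q ha, ?_⟩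
  ext b
  constructor
  · rintro ⟨h, hh, e, he, rfl⟩
    rw [hact.2.1] at hh
    cases hr : act e q with
    | none => simp [hr] at hh
    | some r =>
      have h2 := hact.2.1 e e q
      rw [he, hr, Option.bind_some] at h2
      have hqr := hact.2.2 e q r r hr h2.symm
      rw [hr, Option.bind_some, ← hqr] at hh
      exact hh
  · intro hb
    exact ⟨b, hb, 1, one_mul 1, (one_mul b).symm⟩

/-- If `act m q₁ = some q₂`, then conjugation by `m` carries `Stab(q₁)` into
`Stab(q₂)` and conjugation by `m⁻¹` carries `Stab(q₂)` into `Stab(q₁)`; in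
particular `Stab(q₁)` and `Stab(q₂)` are conjugate closed inverse submonoids. -/
theorem stab_conjugate {M Q : Type*} [Monoid M] (i : M → M)
    (hi : IsInverseMonoidInv M i) (act : M → Q → Option Q)
    (hact : IsPartialAction act) (m : M) (q₁ q₂ : Q)
    (hm : act m q₁ = some q₂) :
    (∀ h ∈ {n : M | act n q₁ = some q₁}, i m * h * m ∈ {n : M | act n q₂ = some q₂}) ∧
    (∀ k ∈ {n : M | act n q₂ = some q₂}, m * k * i m ∈ {n : M | act n q₁ = some q₁}) := by
  have hm' := act_inv_of_act i hi act hact m q₁ q₂ hm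
  have hmul := hact.2.1
  constructor
  · intro h hh
    simp only [Set.mem_setOf_eq] at hh ⊢
    rw [hmul, hmul, hm', Option.bind_some, hh, Option.bind_some, hm]
  · intro k hk
    simp only [Set.mem_setOf_eq] at hk ⊢
    rw [hmul, hmul, hm, Option.bind_some, hk, Option.bind_some, hm']
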